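/- Let Γ ⊂ ℝ^d be an n-dimensional Lipschitz graph with slope < 1, μ := ℋ^n_Γ, and let D = D̃ × ℝ^{d−n} for a cube D̃ ⊂ ℝ^n with 'center' z_D = (z̃_D, 𝒜(z̃_D)) ∈ Γ. For x ∈ Γ ∩ D and 2^{j−1}ℓ(D) ≤ ε' < ε ≤ 2^j ℓ(D) with j large (depending on the slope) and ε − ε' ≥ 2^M ℓ(D), the symmetric difference of the annuli A(x,ε',ε) and A(z_D,ε',ε) intersected with Γ has measure μ(A_sym) ≤ C 2^{j(n−1)} ℓ(D)^n, and consequently ∫_{(3D)^c} |χ_{(ε',ε]}(|x−y|) − χ_{(ε',ε]}(|z_D−y|)| |K(z_D−y)| dμ(y) ≤ C 2^{−j}, where K is any kernel with |K(w)| ≤ C|w|^{−n}. -/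

import Mathlib

open MeasureTheory Metric Set
open scoped NNReal ENNReal symmDiff

/-- Projection onto the first `n` coordinates of `ℝ^{n+m}`. -/
noncomputable def piH (n m : ℕ) (x : EuclideanSpace ℝ (Fin (n + m))) :
    EuclideanSpace ℝ (Fin n) :=
  (WithLp.equiv 2 (Fin n → ℝ)).symm (fun i => x (Fin.castAdd m i))

/-- Projection onto the last `m` coordinates of `ℝ^{n+m}`. -/
noncomputable def piV (n m : ℕ) (x : EuclideanSpace ℝ (Fin (n + m))) :
    EuclideanSpace ℝ (Fin m) :=
  (WithLp.equiv 2 (Fin m → ℝ)).symm (fun i => x (Fin.natAdd n i))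

/-- The point `(z, 𝒜(z))` on the graph of `𝒜`. -/
noncomputable def graphPt (n m : ℕ)
    (A : EuclideanSpace ℝ (Fin n) → EuclideanSpace ℝ (Fin m))
    (z : EuclideanSpace ℝ (Fin n)) : EuclideanSpace ℝ (Fin (n + m)) :=
  (WithLp.equiv 2 (Fin (n + m) → ℝ)).symm (Fin.append (fun i => z i) (fun i => A z i))

/-- The vertical slab `D = D̃ × ℝ^{d−n}` over the cube `D̃ ⊂ ℝ^n` with center `z` and
side length `l`. -/
def slab (n m : ℕ) (z : EuclideanSpace ℝ (Fin n)) (l : ℝ) :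
    Set (EuclideanSpace ℝ (Fin (n + m))) :=
  {x | ∀ i, |piH n m x i - z i| ≤ l / 2}

/-- The half-open annulus `{y : ε' < |x − y| ≤ ε}` (the support of
`χ_{(ε',ε]}(|x − ·|)`). -/
def ann {d : ℕ} (x : EuclideanSpace ℝ (Fin d)) (ε' ε : ℝ) :
    Set (EuclideanSpace ℝ (Fin d)) :=
  {y | ε' < dist x y ∧ dist x y ≤ ε}

/-- Radial contraction estimate: moving towards the origin along a graph of slope less than one
decreases the squared distance to the base point by a definite factor. -/
theorem graph_sq_dist_smul_le {E F : Type*} [NormedAddCommGroup E] [NormedSpace ℝ E]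
    [NormedAddCommGroup F] {A : E → F} {L : ℝ≥0} (hL : L < 1) (hA : LipschitzWith L A)
    (z s : E) {t : ℝ} (ht0 : 0 ≤ t) (ht1 : t ≤ 1) :
    ‖t • s‖ ^ 2 + ‖A (z + t • s) - A z‖ ^ 2 ≤
      (1 - (1 - (L : ℝ) ^ 2) / 2 * (1 - t)) * (‖s‖ ^ 2 + ‖A (z + s) - A z‖ ^ 2) := by
  have hL1 : (L : ℝ) < 1 := by exact_mod_cast hL
  have hL0 : (0 : ℝ) ≤ L := L.coe_nonneg
  have h1 : ‖A (z + s) - A z‖ ≤ L * ‖s‖ := by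
    simpa using hA.norm_sub_le (z + s) z
  have h2 : ‖A (z + t • s) - A z‖ ≤ L * (t * ‖s‖) := by
    simpa [norm_smul, abs_of_nonneg ht0] using hA.norm_sub_le (z + t • s) z
  have h3 : ‖A (z + t • s) - A z‖ ≤ ‖A (z + s) - A z‖ + L * ((1 - t) * ‖s‖) := by
    have h := hA.norm_sub_le (z + t • s) (z + s)
    have e : z + t • s - (z + s) = -((1 - t) • s) := by module
    rw [e, norm_neg, norm_smul, Real.norm_of_nonneg (by linarith)] at h
    have h' := norm_sub_le_norm_sub_add_norm_sub (A (z + t • s)) (A (z + s)) (A z)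
    linarith
  rw [norm_smul, Real.norm_of_nonneg ht0]
  set g := ‖A (z + s) - A z‖
  set k := ‖A (z + t • s) - A z‖
  set r := ‖s‖
  have hg : 0 ≤ g := norm_nonneg _
  have hk : 0 ≤ k := norm_nonneg _
  have hr : 0 ≤ r := norm_nonneg _
  have hu : 0 ≤ 1 - t := by linarith
  have key : k ^ 2 - g ^ 2 ≤ (L : ℝ) ^ 2 * (1 - t ^ 2) * r ^ 2 := by
    rcases le_total k g with h | h
    · have : 0 ≤ (L : ℝ) ^ 2 * (1 - t ^ 2) * r ^ 2 :=
        mul_nonneg (mul_nonneg (sq_nonneg _) (by nlinarith)) (sq_nonneg _)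
      nlinarith
    · calc k ^ 2 - g ^ 2 = (k - g) * (k + g) := by ring
        _ ≤ (L * ((1 - t) * r)) * (L * (t * r) + L * r) := by
          apply mul_le_mul <;> linarith
        _ = _ := by ring
  have hg2 : g ^ 2 ≤ r ^ 2 := by
    have : g ≤ r := h1.trans (by nlinarith)
    gcongr
  have hd : 0 ≤ (1 - (L : ℝ) ^ 2) * (1 - t) := mul_nonneg (by nlinarith) hu
  have h5 : (1 - (L : ℝ) ^ 2) / 2 * (1 - t) * (r ^ 2 + g ^ 2) ≤
      (1 - (L : ℝ) ^ 2) * (1 - t) * r ^ 2 := by nlinarith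
  have h6 : 0 ≤ (1 - (L : ℝ) ^ 2) * (1 - t) * t * r ^ 2 := by positivity
  nlinarith

open scoped Pointwise in
/-- The set of parameters over an annulus of width `b - a` and outer radius `b`, centered at a
point of a Lipschitz graph of slope less than one, has measure at most `C (b - a) b ^ (n - 1)`. -/
theorem exists_measure_graph_annulus_le {E F : Type*} [NormedAddCommGroup E] [NormedSpace ℝ E]
    [FiniteDimensional ℝ E] [MeasurableSpace E] [BorelSpace E] [NormedAddCommGroup F]
    (μ : Measure E) [μ.IsAddHaarMeasure] (hn : 1 ≤ Module.finrank ℝ E)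
    {A : E → F} {L : ℝ≥0} (hL : L < 1) (hA : LipschitzWith L A) :
    ∃ C > (0 : ℝ), ∀ (z : E) (a b : ℝ), 0 ≤ a → a ≤ b → 0 < b →
      μ {s | a ^ 2 < ‖s‖ ^ 2 + ‖A (z + s) - A z‖ ^ 2 ∧
          ‖s‖ ^ 2 + ‖A (z + s) - A z‖ ^ 2 ≤ b ^ 2} ≤
        ENNReal.ofReal (C * (b - a) * b ^ (Module.finrank ℝ E - 1)) := by
  have hL1 : (L : ℝ) < 1 := by exact_mod_cast hL
  have hL0 : (0 : ℝ) ≤ L := L.coe_nonneg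
  obtain ⟨κ, hκ⟩ : ∃ κ : ℝ, κ = (1 - (L : ℝ) ^ 2) / 2 := ⟨_, rfl⟩
  have hκ0 : 0 < κ := by rw [hκ]; nlinarith
  obtain ⟨n, hn'⟩ : ∃ n, Module.finrank ℝ E = n + 1 := ⟨_, (Nat.sub_add_cancel hn).symm⟩
  set v : ℝ := μ.real (closedBall (0 : E) 1)
  have hv0 : 0 < v :=
    ENNReal.toReal_pos (measure_closedBall_pos μ _ one_pos).ne' measure_closedBall_lt_top.ne
  refine ⟨(n + 1) * (2 / κ) * v, by positivity, fun z a b ha hab hb ↦ ?_⟩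
  rw [hn', Nat.add_sub_cancel]
  let q : E → ℝ := fun s ↦ ‖s‖ ^ 2 + ‖A (z + s) - A z‖ ^ 2
  let S : ℝ → Set E := fun c ↦ {s | q s ≤ c ^ 2}
  have hq : Continuous q := by
    have := hA.continuous
    fun_prop
  have hSm : ∀ c, MeasurableSet (S c) := fun c ↦ (isClosed_le hq continuous_const).measurableSet
  have hSb : S b ⊆ closedBall 0 b := fun s hs ↦ by
    rw [mem_closedBall_zero_iff]
    refine abs_le_of_sq_le_sq' ?_ hb.le |>.2
    have : q s ≤ b ^ 2 := hs
    exact (le_add_of_nonneg_right (sq_nonneg _)).trans this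
  have hSfin : μ (S b) ≠ ∞ := ((measure_mono hSb).trans_lt measure_closedBall_lt_top).ne
  have hball : μ.real (S b) ≤ b ^ (n + 1) * v := by
    have h := measureReal_mono (μ := μ) hSb measure_closedBall_lt_top.ne
    rwa [Measure.real, Measure.real, Measure.addHaar_closedBall' μ _ hb.le, ENNReal.toReal_mul, hn',
      ENNReal.toReal_ofReal (by positivity)] at h
  have hsub : S a ⊆ S b := fun s (hs : q s ≤ a ^ 2) ↦ hs.trans (by gcongr)
  have hset : {s | a ^ 2 < q s ∧ q s ≤ b ^ 2} = S b \ S a := by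
    ext s
    simp only [S, mem_sdiff, mem_ofPred_eq, not_le]
    exact and_comm
  change μ {s | a ^ 2 < q s ∧ q s ≤ b ^ 2} ≤ _
  rw [hset]
  obtain ⟨δ, hδ⟩ : ∃ δ : ℝ, δ = 2 * (b - a) / (κ * b) := ⟨_, rfl⟩
  have hδ0 : 0 ≤ δ := by rw [hδ]; exact div_nonneg (by linarith) (by positivity)
  have hδκ : κ * δ * b = 2 * (b - a) := by rw [hδ]; field_simp
  have hgoal : μ.real (S b \ S a) ≤ (n + 1) * δ * (b ^ (n + 1) * v) := by
    rcases le_total δ 1 with h | h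
    · have hinc : (1 - δ) • S b ⊆ S a := by
        rintro _ ⟨s, hs, rfl⟩
        have hs : q s ≤ b ^ 2 := hs
        have h1 : q ((1 - δ) • s) ≤ (1 - κ * δ) * q s := by
          have := graph_sq_dist_smul_le hL hA z s (sub_nonneg.2 h) (sub_le_self 1 hδ0)
          rwa [sub_sub_cancel, ← hκ] at this
        have hκ1 : κ ≤ 1 / 2 := by rw [hκ]; nlinarith
        have h2 : (1 - κ * δ) * q s ≤ (1 - κ * δ) * b ^ 2 := by
          gcongr
          nlinarith
        refine h1.trans (h2.trans ?_)
        nlinarith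
      have hm := measureReal_mono (μ := μ) hinc ((measure_mono hsub).trans_lt hSfin.lt_top).ne
      rw [Measure.real, Measure.addHaar_smul, hn', ENNReal.toReal_mul,
        ENNReal.toReal_ofReal (abs_nonneg _), abs_of_nonneg (pow_nonneg (sub_nonneg.2 h) _)] at hm
      change (1 - δ) ^ (n + 1) * μ.real (S b) ≤ _ at hm
      have hbern := one_add_mul_le_pow (a := -δ) (by linarith) (n + 1)
      rw [← sub_eq_add_neg] at hbern
      push_cast at hbern
      have hdiff := measureReal_sdiff (μ := μ) hsub (hSm a) hSfin
      have h0 : 0 ≤ μ.real (S b) := measureReal_nonneg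
      have h3 := mul_le_mul_of_nonneg_right hbern h0
      have h4 : (n + 1) * δ * μ.real (S b) ≤ (n + 1) * δ * (b ^ (n + 1) * v) := by gcongr
      linarith
    · have h1 : μ.real (S b \ S a) ≤ μ.real (S b) := measureReal_mono sdiff_subset hSfin
      have h2 : 1 ≤ (n + 1) * δ := by
        have : (0 : ℝ) ≤ n := n.cast_nonneg
        nlinarith
      have h3 : 0 ≤ b ^ (n + 1) * v := by positivity
      nlinarith
  have hfin : μ (S b \ S a) ≠ ∞ := ((measure_mono sdiff_subset).trans_lt hSfin.lt_top).ne
  rw [← ENNReal.ofReal_toReal hfin]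
  refine ENNReal.ofReal_le_ofReal (hgoal.trans (le_of_eq ?_))
  rw [hδ]
  field_simp
  ring

theorem piH_graphPt (n m : ℕ) (A : EuclideanSpace ℝ (Fin n) → EuclideanSpace ℝ (Fin m))
    (z : EuclideanSpace ℝ (Fin n)) : piH n m (graphPt n m A z) = z := by
  ext i
  simp [piH, graphPt]

theorem piV_graphPt (n m : ℕ) (A : EuclideanSpace ℝ (Fin n) → EuclideanSpace ℝ (Fin m))
    (z : EuclideanSpace ℝ (Fin n)) : piV n m (graphPt n m A z) = A z := by
  ext i
  simp [piV, graphPt]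

theorem graphPt_piH {n m : ℕ} {A : EuclideanSpace ℝ (Fin n) → EuclideanSpace ℝ (Fin m)}
    {x : EuclideanSpace ℝ (Fin (n + m))} (hx : piV n m x = A (piH n m x)) :
    graphPt n m A (piH n m x) = x := by
  ext i
  refine Fin.addCases (fun i ↦ ?_) (fun i ↦ ?_) i
  · simp [piH, graphPt]
  · simp [graphPt, ← hx, piV]

theorem dist_sq_eq_piH_add_piV (n m : ℕ) (x y : EuclideanSpace ℝ (Fin (n + m))) :
    dist x y ^ 2 = ‖piH n m x - piH n m y‖ ^ 2 + ‖piV n m x - piV n m y‖ ^ 2 := by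
  simp [dist_eq_norm, EuclideanSpace.norm_sq_eq, Fin.sum_univ_add, piH, piV]

theorem dist_sq_graphPt (n m : ℕ) (A : EuclideanSpace ℝ (Fin n) → EuclideanSpace ℝ (Fin m))
    (s t : EuclideanSpace ℝ (Fin n)) :
    dist (graphPt n m A s) (graphPt n m A t) ^ 2 = ‖s - t‖ ^ 2 + ‖A s - A t‖ ^ 2 := by
  simp only [dist_sq_eq_piH_add_piV, piH_graphPt, piV_graphPt]

theorem lipschitzWith_graphPt {n m : ℕ}
    {A : EuclideanSpace ℝ (Fin n) → EuclideanSpace ℝ (Fin m)} {L : ℝ≥0} (hL : L < 1)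
    (hA : LipschitzWith L A) : LipschitzWith 2 (graphPt n m A) := by
  refine LipschitzWith.of_dist_le_mul fun s t ↦ ?_
  have hL1 : (L : ℝ) < 1 := by exact_mod_cast hL
  refine abs_le_of_sq_le_sq' ?_ (by positivity) |>.2
  rw [dist_sq_graphPt, dist_eq_norm]
  have h1 := hA.norm_sub_le s t
  have h2 : ‖A s - A t‖ ≤ ‖s - t‖ := h1.trans (by nlinarith [norm_nonneg (s - t)])
  have h3 : ‖A s - A t‖ ^ 2 ≤ ‖s - t‖ ^ 2 := by gcongr
  push_cast
  nlinarith [sq_nonneg ‖s - t‖]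

theorem measurableSet_ann {d : ℕ} (x : EuclideanSpace ℝ (Fin d)) (a b : ℝ) :
    MeasurableSet (ann x a b) := by
  have h : Continuous fun y ↦ dist x y := by fun_prop
  exact (isOpen_lt continuous_const h).measurableSet.inter
    (isClosed_le h continuous_const).measurableSet

/-- Moving the center of an annulus by a distance `r` changes it only inside two annuli of
width `2 r`. -/
theorem ann_symmDiff_subset {d : ℕ} (x z : EuclideanSpace ℝ (Fin d)) (a b : ℝ) :
    ann x a b ∆ ann z a b ⊆
      ann z (a - dist x z) (a + dist x z) ∪ ann z (b - dist x z) (b + dist x z) := by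
  have hr : 0 ≤ dist x z := dist_nonneg
  intro y hy
  have h1 : dist x y ≤ dist x z + dist z y := dist_triangle _ _ _
  have h2 : dist z y ≤ dist x z + dist x y := dist_triangle_left _ _ _
  simp only [mem_union, mem_symmDiff, ann, mem_ofPred_eq, not_and_or, not_lt, not_le] at hy ⊢
  rcases hy with ⟨⟨h3, h4⟩, h5 | h5⟩ | ⟨⟨h3, h4⟩, h5 | h5⟩
  · left; constructor <;> linarith
  · right; constructor <;> linarith
  · left; constructor <;> linarith
  · right; constructor <;> linarith

theorem dist_graphPt_le_of_mem_slab {n m : ℕ}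
    {A : EuclideanSpace ℝ (Fin n) → EuclideanSpace ℝ (Fin m)} {L : ℝ≥0} (hL : L < 1)
    (hA : LipschitzWith L A) {z : EuclideanSpace ℝ (Fin n)} {l : ℝ} (hl : 0 < l)
    {x : EuclideanSpace ℝ (Fin (n + m))} (hx : piV n m x = A (piH n m x))
    (hxs : x ∈ slab n m z l) : dist x (graphPt n m A z) ≤ 2 * (n * l) := by
  rw [← graphPt_piH hx]
  refine ((lipschitzWith_graphPt hL hA).dist_le_mul _ _).trans ?_
  have hsum : dist (piH n m x) z ^ 2 ≤ (n * l) ^ 2 := by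
    rw [dist_eq_norm, EuclideanSpace.norm_sq_eq]
    calc ∑ i, ‖(piH n m x - z) i‖ ^ 2 ≤ ∑ _i : Fin n, l ^ 2 := by
          refine Finset.sum_le_sum fun i _ ↦ ?_
          have := hxs i
          have h : ‖(piH n m x - z) i‖ ≤ l := by
            rw [PiLp.sub_apply, Real.norm_eq_abs]
            linarith
          gcongr
      _ = n * l ^ 2 := by simp
      _ ≤ (n * l) ^ 2 := by
          have : (n : ℝ) ≤ (n : ℝ) ^ 2 := by exact_mod_cast Nat.le_self_pow two_ne_zero n
          rw [mul_pow]
          gcongr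
  have := (abs_le_of_sq_le_sq' hsum (by positivity)).2
  push_cast
  gcongr

/-- Annuli centered on a Lipschitz graph `Γ` of slope less than one satisfy
`ℋⁿ(Γ ∩ A(u, a, b)) ≤ C (b - a) b ^ (n - 1)`. -/
theorem exists_hausdorffMeasure_graph_ann_le {n m : ℕ} (hn : 1 ≤ n)
    {A : EuclideanSpace ℝ (Fin n) → EuclideanSpace ℝ (Fin m)} {L : ℝ≥0} (hL : L < 1)
    (hA : LipschitzWith L A) :
    ∃ C > (0 : ℝ), ∀ (z : EuclideanSpace ℝ (Fin n)) (a b : ℝ), 0 ≤ a → a ≤ b → 0 < b →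
      (μH[n]).restrict {x | piV n m x = A (piH n m x)} (ann (graphPt n m A z) a b) ≤
        ENNReal.ofReal (C * (b - a) * b ^ (n - 1)) := by
  have hfr : Module.finrank ℝ (EuclideanSpace ℝ (Fin n)) = n := finrank_euclideanSpace_fin
  have hHaar : (μH[n] : Measure (EuclideanSpace ℝ (Fin n))).IsAddHaarMeasure := by
    have := isAddHaarMeasure_hausdorffMeasure (E := EuclideanSpace ℝ (Fin n))
    rwa [hfr] at this
  obtain ⟨C, hC, h⟩ := exists_measure_graph_annulus_le
    (μH[n] : Measure (EuclideanSpace ℝ (Fin n))) (hn.trans_eq hfr.symm) hL hA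
  rw [hfr] at h
  refine ⟨2 ^ n * C, by positivity, fun z a b ha hab hb ↦ ?_⟩
  rw [Measure.restrict_apply (measurableSet_ann _ _ _)]
  set T := {s | a ^ 2 < ‖s‖ ^ 2 + ‖A (z + s) - A z‖ ^ 2 ∧
          ‖s‖ ^ 2 + ‖A (z + s) - A z‖ ^ 2 ≤ b ^ 2} with hT
  have hlip : LipschitzWith 2 fun s ↦ graphPt n m A (z + s) := by
    simpa [Function.comp_def] using (lipschitzWith_graphPt hL hA).comp (isometry_add_left z).lipschitz
  have hsub : ann (graphPt n m A z) a b ∩ {x | piV n m x = A (piH n m x)} ⊆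
      (fun s ↦ graphPt n m A (z + s)) '' T := by
    rintro y ⟨⟨h1, h2⟩, hy⟩
    have hy' : graphPt n m A (z + (piH n m y - z)) = y := by
      rw [add_sub_cancel, graphPt_piH hy]
    refine ⟨piH n m y - z, ?_, hy'⟩
    have hd : dist (graphPt n m A z) y ^ 2 = ‖piH n m y - z‖ ^ 2 +
        ‖A (z + (piH n m y - z)) - A z‖ ^ 2 := by
      conv_lhs => rw [← hy', dist_comm, dist_sq_graphPt, add_sub_cancel_left]
    rw [hT, mem_ofPred_eq, ← hd]
    exact ⟨by gcongr, by gcongr⟩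
  calc μH[n] (ann (graphPt n m A z) a b ∩ {x | piV n m x = A (piH n m x)})
      ≤ μH[n] ((fun s ↦ graphPt n m A (z + s)) '' T) := measure_mono hsub
    _ ≤ ((2 : ℝ≥0) : ℝ≥0∞) ^ (n : ℝ) * μH[n] T :=
      hlip.hausdorffMeasure_image_le n.cast_nonneg T
    _ ≤ ENNReal.ofReal (2 ^ n) * ENNReal.ofReal (C * (b - a) * b ^ (n - 1)) := by
      gcongr
      · rw [ENNReal.rpow_natCast, ENNReal.ofReal_pow (by norm_num)]
        simp
      · exact h z a b ha hab hb
    _ = _ := by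
      rw [← ENNReal.ofReal_mul (by positivity)]
      ring_nf

/-- Key estimate in the proof of the `L^∞ → BMO` bound: for a Lipschitz
graph `Γ` of slope `< 1` with `μ := ℋ^n_Γ`, a slab `D` with graph center `z_D`, an integer
`M` (depending only on the slope) with `|x − z_D| < 2^M ℓ(D)` on `Γ ∩ D`, and truncation
radii `2^{j−1}ℓ(D) ≤ ε' < ε ≤ 2^j ℓ(D)` with `j > M + 2` and `ε − ε' ≥ 2^M ℓ(D)`, the
symmetric difference of the annuli `A(x,ε',ε)` and `A(z_D,ε',ε)` has
`μ`-measure `≤ C 2^{j(n−1)} ℓ(D)^n`, and consequently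
`∫_{(3D)^c} |χ_{(ε',ε]}(|x−y|) − χ_{(ε',ε]}(|z_D−y|)| |K(z_D−y)| dμ(y) ≤ C 2^{−j}`
for any kernel with `|K(w)| ≤ C_K |w|^{−n}`. -/
theorem stmt17 (n m : ℕ) (hn : 1 ≤ n) (hm : 1 ≤ m)
    (A : EuclideanSpace ℝ (Fin n) → EuclideanSpace ℝ (Fin m)) (L : ℝ≥0) (hL : L < 1)
    (hA : LipschitzWith L A)
    (K : EuclideanSpace ℝ (Fin (n + m)) → ℂ) (CK : ℝ) (hCK : 0 < CK)
    (hK0 : ∀ w : EuclideanSpace ℝ (Fin (n + m)), w ≠ 0 → ‖K w‖ ≤ CK / ‖w‖ ^ n) :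
    ∃ C > (0 : ℝ), ∀ (z : EuclideanSpace ℝ (Fin n)) (l : ℝ), 0 < l →
      ∀ M : ℕ, 10 < M →
      (∀ x ∈ {x | piV n m x = A (piH n m x)} ∩ slab n m z l,
        dist x (graphPt n m A z) < 2 ^ M * l) →
      ∀ j : ℕ, M + 2 < j →
      ∀ ε' ε : ℝ, 2 ^ (j - 1) * l ≤ ε' → ε' < ε → ε ≤ 2 ^ j * l → 2 ^ M * l ≤ ε - ε' →
      ∀ x ∈ {x | piV n m x = A (piH n m x)} ∩ slab n m z l,
        (μH[n]).restrict {x | piV n m x = A (piH n m x)}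
            (ann x ε' ε ∆ ann (graphPt n m A z) ε' ε)
          ≤ ENNReal.ofReal (C * 2 ^ (j * (n - 1)) * l ^ n) ∧
        ∫⁻ y in (slab n m z (3 * l))ᶜ ∩ (ann x ε' ε ∆ ann (graphPt n m A z) ε' ε),
            ENNReal.ofReal ‖K (graphPt n m A z - y)‖
            ∂((μH[n]).restrict {x | piV n m x = A (piH n m x)})
          ≤ ENNReal.ofReal (C * (2 : ℝ) ^ (-(j : ℤ))) := by
  obtain ⟨C, hC, hann⟩ := exists_hausdorffMeasure_graph_ann_le hn hL hA
  have hn0 : (0 : ℝ) < n := by exact_mod_cast hn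
  obtain ⟨C₁, hC₁⟩ : ∃ C₁ : ℝ, C₁ = C * (8 * n) * 2 ^ (n - 1) := ⟨_, rfl⟩
  have hC₁0 : 0 < C₁ := by rw [hC₁]; positivity
  refine ⟨C₁ * (1 + CK * 4 ^ n), by positivity, ?_⟩
  intro z l hl M _ hM j hj ε' ε h1 h2 h3 _ x hx
  have hrM := hM x hx
  have hrl := dist_graphPt_le_of_mem_slab hL hA hl hx.1 hx.2
  have hsub := ann_symmDiff_subset x (graphPt n m A z) ε' ε
  have hr0 : 0 ≤ dist x (graphPt n m A z) := dist_nonneg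
  set u := graphPt n m A z
  set r := dist x u
  set ν := (μH[n]).restrict {x | piV n m x = A (piH n m x)}
  have hpj : (2 : ℝ) ^ j = 2 * 2 ^ (j - 1) := by
    rw [← pow_succ', Nat.sub_add_cancel (by omega)]
  have hpM : 4 * (2 : ℝ) ^ M ≤ 2 ^ (j - 1) := by
    calc 4 * (2 : ℝ) ^ M = 2 ^ (M + 2) := by ring
      _ ≤ 2 ^ (j - 1) := pow_le_pow_right₀ one_le_two (by omega)
  have hpMl : 4 * (2 ^ M * l) ≤ 2 ^ (j - 1) * l := by nlinarith
  have hlow : 2 ^ j * l / 4 ≤ ε' - r := by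
    rw [hpj]
    linarith
  have hjl : 0 < 2 ^ j * l := by positivity
  have hup : ε + r ≤ 2 * (2 ^ j * l) := by
    rw [hpj] at h3 ⊢
    have : 0 < 2 ^ M * l := by positivity
    linarith
  have hone : ∀ e : ℝ, ε' ≤ e → e ≤ ε →
      ν (ann u (e - r) (e + r)) ≤
        ENNReal.ofReal (C * (4 * (n * l)) * (2 * (2 ^ j * l)) ^ (n - 1)) := by
    intro e he1 he2
    refine (hann z (e - r) (e + r) (by linarith) (by linarith) (by linarith)).trans
      (ENNReal.ofReal_le_ofReal ?_)
    have : 0 ≤ e + r := by linarith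
    gcongr <;> linarith
  have hmeas : ν (ann x ε' ε ∆ ann u ε' ε) ≤
      ENNReal.ofReal (C₁ * 2 ^ (j * (n - 1)) * l ^ n) := by
    calc ν (ann x ε' ε ∆ ann u ε' ε)
        ≤ ν (ann u (ε' - r) (ε' + r)) + ν (ann u (ε - r) (ε + r)) :=
          (measure_mono hsub).trans (measure_union_le _ _)
      _ ≤ _ := add_le_add (hone ε' le_rfl h2.le) (hone ε h2.le le_rfl)
      _ = _ := by
        rw [← ENNReal.ofReal_add (by positivity) (by positivity), hC₁, mul_pow, mul_pow, ← pow_mul]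
        congr 1
        obtain ⟨k, rfl⟩ : ∃ k, n = k + 1 := ⟨n - 1, by omega⟩
        rw [Nat.add_sub_cancel]
        ring
  refine ⟨hmeas.trans (ENNReal.ofReal_le_ofReal ?_), ?_⟩
  · have : 1 ≤ 1 + CK * 4 ^ n := le_add_of_nonneg_right (by positivity)
    gcongr
    exact le_mul_of_one_le_right hC₁0.le this
  have hK : ∀ y ∈ ann x ε' ε ∆ ann u ε' ε,
      ENNReal.ofReal ‖K (u - y)‖ ≤ ENNReal.ofReal (CK / (2 ^ j * l / 4) ^ n) := by
    intro y hy
    have hy' : 2 ^ j * l / 4 ≤ ‖u - y‖ := by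
      rw [← dist_eq_norm]
      rcases hsub hy with h | h <;> have := h.1 <;> linarith
    refine ENNReal.ofReal_le_ofReal ((hK0 _ ?_).trans (by gcongr))
    exact norm_pos_iff.1 (lt_of_lt_of_le (by positivity) hy')
  calc ∫⁻ y in (slab n m z (3 * l))ᶜ ∩ (ann x ε' ε ∆ ann u ε' ε), ENNReal.ofReal ‖K (u - y)‖ ∂ν
      ≤ ∫⁻ y in ann x ε' ε ∆ ann u ε' ε, ENNReal.ofReal ‖K (u - y)‖ ∂ν :=
        lintegral_mono_set inter_subset_right
    _ ≤ ∫⁻ _ in ann x ε' ε ∆ ann u ε' ε, ENNReal.ofReal (CK / (2 ^ j * l / 4) ^ n) ∂ν :=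
        setLIntegral_mono' ((measurableSet_ann _ _ _).symmDiff (measurableSet_ann _ _ _)) hK
    _ = ENNReal.ofReal (CK / (2 ^ j * l / 4) ^ n) * ν (ann x ε' ε ∆ ann u ε' ε) :=
        setLIntegral_const _ _
    _ ≤ ENNReal.ofReal (CK / (2 ^ j * l / 4) ^ n) *
        ENNReal.ofReal (C₁ * 2 ^ (j * (n - 1)) * l ^ n) := by gcongr
    _ = ENNReal.ofReal (C₁ * (CK * 4 ^ n) * (2 : ℝ) ^ (-(j : ℤ))) := by
        rw [← ENNReal.ofReal_mul (by positivity), zpow_neg, zpow_natCast]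
        congr 1
        obtain ⟨k, rfl⟩ : ∃ k, n = k + 1 := ⟨n - 1, by omega⟩
        rw [Nat.add_sub_cancel, pow_mul]
        field_simp
        rw [← mul_pow, div_mul_cancel₀ _ four_ne_zero, mul_pow]
        ring
    _ ≤ _ := by
        refine ENNReal.ofReal_le_ofReal ?_
        gcongr
        linarith
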